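/- The reflections s_β for β ∈ ℬ pairwise commute, and their product (in any order) equals the longest element w₀ of the Weyl group W. Moreover, for each β ∈ ℬ, w₀ maps Δ(β) onto itself, and the restriction of w₀ to the linear span of Δ(β) coincides with the restriction of the longest element of the Weyl group of Δ(β). -/

import Mathlib

open scoped InnerProductSpace BigOperators

structure RootSystemData (V : Type*) [NormedAddCommGroup V] [InnerProductSpace ℝ V] where
  Δ : Set V
  finite : Δ.Finite
  span_top : Submodule.span ℝ Δ = ⊤
  zero_not_mem : (0 : V) ∉ Δ
  neg_mem : ∀ α ∈ Δ, -α ∈ Δ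
  reduced : ∀ α ∈ Δ, ∀ t : ℝ, t • α ∈ Δ → t = 1 ∨ t = -1
  crystal : ∀ α ∈ Δ, ∀ β ∈ Δ, ∃ n : ℤ, 2 * ⟪α, β⟫_ℝ = (n : ℝ) * ⟪β, β⟫_ℝ
  reflect_mem : ∀ α ∈ Δ, ∀ β ∈ Δ, α - (2 * ⟪α, β⟫_ℝ / ⟪β, β⟫_ℝ) • β ∈ Δ
  Pos : Set V
  pos_subset : Pos ⊆ Δ
  mem_or_neg : ∀ α ∈ Δ, α ∈ Pos ∨ -α ∈ Pos
  not_neg_mem : ∀ α ∈ Pos, -α ∉ Pos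
  pos_add : ∀ α ∈ Pos, ∀ β ∈ Pos, α + β ∈ Δ → α + β ∈ Pos

namespace RootSystemData

variable {V : Type*} [NormedAddCommGroup V] [InnerProductSpace ℝ V] (R : RootSystemData V)

/-- The set of simple roots: indecomposable positive roots. -/
def Simple : Set V := {α ∈ R.Pos | ¬ ∃ β ∈ R.Pos, ∃ γ ∈ R.Pos, α = β + γ}

/-- The support `Π(φ)` of a positive root: the simple roots needed to express `φ`. -/
def support (φ : V) : Set V := {α ∈ R.Simple | φ ∉ Submodule.span ℝ (R.Simple \ {α})}

/-- The root subsystem `Δ(φ)`: all roots lying in the span of the support of `φ`. -/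
def sub (φ : V) : Set V := {ψ ∈ R.Δ | ψ ∈ Submodule.span ℝ (R.support φ)}

/-- The positive roots `Δ(φ)₊` of the subsystem `Δ(φ)`. -/
def posSub (φ : V) : Set V := R.sub φ ∩ R.Pos

/-- `x` is a nonnegative integer combination of positive roots. -/
def NonnegComb (x : V) : Prop :=
  ∃ c : V →₀ ℕ, ↑c.support ⊆ R.Pos ∧ x = c.sum fun α n => (n : ℝ) • α

/-- `β` is the highest root of the subset `S`. -/
def IsHighest (S : Set V) (β : V) : Prop :=
  β ∈ S ∧ β ∈ R.Pos ∧ ∀ ψ ∈ S, R.NonnegComb (β - ψ)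

/-- `β` is locally high: it is the highest root of `Δ(β)`. -/
def LocallyHigh (β : V) : Prop := β ∈ R.Pos ∧ R.IsHighest (R.sub β) β

/-- `E(β) = {φ ∈ Δ(β) : (φ,β) > 0}`. -/
def E (β : V) : Set V := {φ ∈ R.sub β | 0 < ⟪φ, β⟫_ℝ}

/-- `Δ(β)° = {φ ∈ Δ(β) : (φ,β) = 0}`. -/
def orth (β : V) : Set V := {φ ∈ R.sub β | ⟪φ, β⟫_ℝ = 0}

/-- Strong orthogonality of two roots. -/
def StronglyOrth (φ ψ : V) : Prop := φ + ψ ∉ R.Δ ∧ φ - ψ ∉ R.Δ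


/-- Half the sum of the positive roots of `Δ(β)`. -/
noncomputable def rho (β : V) : V := (2⁻¹ : ℝ) • ∑ᶠ φ ∈ R.posSub β, φ

/-- The dual Coxeter number of `Δ(β)`, `⟨ρ_β, β^∨⟩ + 1`. -/
noncomputable def dualCoxeter (β : V) : ℝ := 2 * ⟪R.rho β, β⟫_ℝ / ⟪β, β⟫_ℝ + 1

end RootSystemData

/-- A finite set of vectors is irreducible if it is nonempty and admits no splitting into
two nonempty mutually orthogonal pieces. -/
def IsIrred {V : Type*} [NormedAddCommGroup V] [InnerProductSpace ℝ V] (S : Set V) : Prop :=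
  S.Nonempty ∧ ¬ ∃ A B : Set V, A ∪ B = S ∧ A ∩ B = ∅ ∧ A.Nonempty ∧ B.Nonempty ∧
    ∀ a ∈ A, ∀ b ∈ B, ⟪a, b⟫_ℝ = 0

/-- `C` is an irreducible component of `S`. -/
def IsComponent {V : Type*} [NormedAddCommGroup V] [InnerProductSpace ℝ V]
    (S C : Set V) : Prop :=
  C ⊆ S ∧ IsIrred C ∧ ∀ a ∈ C, ∀ b ∈ S \ C, ⟪a, b⟫_ℝ = 0

/-- The reflection `s_β` in the (co)vector `β`. -/
noncomputable def reflectRoot {V : Type*} [NormedAddCommGroup V] [InnerProductSpace ℝ V]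
    (β v : V) : V := v - (2 * ⟪v, β⟫_ℝ / ⟪β, β⟫_ℝ) • β

namespace RootSystemData

variable {V : Type*} [NormedAddCommGroup V] [InnerProductSpace ℝ V] (R : RootSystemData V)

/-- A chain cascade: a nonempty list whose head is the highest root of an irreducible
component of `Δ`, and each subsequent entry is the highest root of an irreducible component
of `Δ(previous)°`. -/
def IsChainCascade (l : List V) : Prop :=
  l ≠ [] ∧
  (∀ b ∈ l.head?, ∃ C, IsComponent R.Δ C ∧ R.IsHighest C b) ∧
  l.Chain' fun γ δ => ∃ C, IsComponent (R.orth γ) C ∧ R.IsHighest C δ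

/-- The cascade `ℬ` of roots: all positive roots belonging to some chain cascade. -/
def cascade : Set V := {β | ∃ l, R.IsChainCascade l ∧ β ∈ l}

/-- `l` is the chain cascade `C(φ)` associated to the positive root `φ`. -/
def IsCascadeChainOf (φ : V) (l : List V) : Prop :=
  R.IsChainCascade l ∧ (∀ β ∈ l, φ ∈ R.sub β) ∧
  (∀ β ∈ l.dropLast, ⟪φ, β⟫_ℝ = 0) ∧ ∀ β ∈ l.getLast?, 0 < ⟪φ, β⟫_ℝ

end RootSystemData

section Reflections

variable {V : Type*} [NormedAddCommGroup V] [InnerProductSpace ℝ V]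

theorem inner_reflectRoot (β v w : V) :
    ⟪reflectRoot β v, w⟫_ℝ = ⟪v, w⟫_ℝ - 2 * ⟪v, β⟫_ℝ / ⟪β, β⟫_ℝ * ⟪β, w⟫_ℝ := by
  simp [reflectRoot, inner_sub_left, real_inner_smul_left]

theorem inner_reflectRoot_self {β : V} (hβ : β ≠ 0) (v : V) :
    ⟪reflectRoot β v, β⟫_ℝ = -⟪v, β⟫_ℝ := by
  have h : ⟪β, β⟫_ℝ ≠ 0 := inner_self_ne_zero.2 hβ
  rw [inner_reflectRoot]
  field_simp
  ring

theorem reflectRoot_of_inner_eq_zero {β v : V} (h : ⟪v, β⟫_ℝ = 0) : reflectRoot β v = v := by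
  simp [reflectRoot, h]

theorem reflectRoot_reflectRoot {β : V} (hβ : β ≠ 0) (v : V) :
    reflectRoot β (reflectRoot β v) = v := by
  have h : reflectRoot β (reflectRoot β v)
      = reflectRoot β v - (2 * ⟪reflectRoot β v, β⟫_ℝ / ⟪β, β⟫_ℝ) • β := rfl
  rw [h, inner_reflectRoot_self hβ, reflectRoot]
  module

theorem reflectRoot_injective {β : V} (hβ : β ≠ 0) : Function.Injective (reflectRoot β) :=
  Function.LeftInverse.injective (reflectRoot_reflectRoot hβ)

theorem reflectRoot_comm_of_inner_eq_zero {β γ : V} (h : ⟪β, γ⟫_ℝ = 0) :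
    reflectRoot β ∘ reflectRoot γ = reflectRoot γ ∘ reflectRoot β := by
  have h' : ⟪γ, β⟫_ℝ = 0 := by rwa [real_inner_comm]
  funext v
  simp only [Function.comp, reflectRoot, inner_sub_left, real_inner_smul_left, h, h']
  simp only [mul_zero, sub_zero]
  abel

theorem inner_eq_zero_of_mem_span {A B : Set V} (h : ∀ a ∈ A, ∀ b ∈ B, ⟪a, b⟫_ℝ = 0) {x y : V}
    (hx : x ∈ Submodule.span ℝ A) (hy : y ∈ Submodule.span ℝ B) : ⟪x, y⟫_ℝ = 0 :=
  (Submodule.isOrtho_span.2 fun a ha b hb => h a ha b hb).inner_eq hx hy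

end Reflections

namespace RootSystemData

variable {V : Type*} [NormedAddCommGroup V] [InnerProductSpace ℝ V] (R : RootSystemData V)

theorem ne_zero {α : V} (h : α ∈ R.Δ) : α ≠ 0 := fun h0 => R.zero_not_mem (h0 ▸ h)

theorem pos_ne_zero {α : V} (h : α ∈ R.Pos) : α ≠ 0 := R.ne_zero (R.pos_subset h)

theorem inner_self_pos {α : V} (h : α ∈ R.Δ) : 0 < ⟪α, α⟫_ℝ :=
  real_inner_self_pos.2 (R.ne_zero h)

theorem finite_pos : R.Pos.Finite := R.finite.subset R.pos_subset

theorem reflectRoot_mem {α β : V} (hα : α ∈ R.Δ) (hβ : β ∈ R.Δ) : reflectRoot β α ∈ R.Δ :=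
  R.reflect_mem α hα β hβ

theorem sub_mem_of_inner_pos {α β : V} (hα : α ∈ R.Δ) (hβ : β ∈ R.Δ)
    (h : 0 < ⟪α, β⟫_ℝ) (hne : α ≠ β) : α - β ∈ R.Δ := by
  obtain ⟨p, hp⟩ := R.crystal α hα β hβ
  obtain ⟨q, hq⟩ := R.crystal β hβ α hα
  have hαα := R.inner_self_pos hα
  have hββ := R.inner_self_pos hβ
  have hc : ⟪β, α⟫_ℝ = ⟪α, β⟫_ℝ := real_inner_comm _ _
  rw [hc] at hq
  have hp0 : 0 < p := by
    have : (0 : ℝ) < p := by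
      by_contra hle
      nlinarith
    exact_mod_cast this
  have hq0 : 0 < q := by
    have : (0 : ℝ) < q := by
      by_contra hle
      nlinarith
    exact_mod_cast this
  by_cases hp1 : p = 1
  · have := R.reflect_mem α hα β hβ
    rwa [hp, hp1, Int.cast_one, one_mul, div_self hββ.ne', one_smul] at this
  by_cases hq1 : q = 1
  · have := R.reflect_mem β hβ α hα
    rw [hc, hq, hq1, Int.cast_one, one_mul, div_self hαα.ne', one_smul] at this
    simpa using R.neg_mem _ this
  exfalso
  have hp2 : (2 : ℝ) ≤ p := by exact_mod_cast (show 2 ≤ p by omega)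
  have hq2 : (2 : ℝ) ≤ q := by exact_mod_cast (show 2 ≤ q by omega)
  have h1 : ⟪α - β, α - β⟫_ℝ ≤ 0 := by
    rw [inner_sub_left, inner_sub_right, inner_sub_right, hc]
    nlinarith
  exact hne (sub_eq_zero.1 (real_inner_self_nonpos.1 h1))

theorem add_mem_of_inner_neg {α β : V} (hα : α ∈ R.Δ) (hβ : β ∈ R.Δ)
    (h : ⟪α, β⟫_ℝ < 0) (hne : α + β ≠ 0) : α + β ∈ R.Δ := by
  have := R.sub_mem_of_inner_pos hα (R.neg_mem β hβ) (by simpa using h)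
    (fun h' => hne (by rw [h']; simp))
  simpa using this

/-- The additive monoid generated by the positive roots. -/
abbrev posCone : AddSubmonoid V := AddSubmonoid.closure R.Pos

theorem pos_mem_posCone {α : V} (h : α ∈ R.Pos) : α ∈ R.posCone :=
  AddSubmonoid.subset_closure h

theorem nonnegComb_iff {x : V} : R.NonnegComb x ↔ x ∈ R.posCone := by
  classical
  constructor
  · rintro ⟨c, hc, rfl⟩
    refine AddSubmonoid.sum_mem _ fun α hα => ?_
    simp only [Nat.cast_smul_eq_nsmul]
    exact AddSubmonoid.nsmul_mem _ (R.pos_mem_posCone (hc hα)) _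
  · intro hx
    induction hx using AddSubmonoid.closure_induction with
    | mem x hx =>
      refine ⟨Finsupp.single x 1, ?_, by simp⟩
      intro y hy
      simp at hy
      exact hy ▸ hx
    | zero => exact ⟨0, by simp, by simp⟩
    | add x y _ _ hx hy =>
      obtain ⟨c, hc, rfl⟩ := hx
      obtain ⟨d, hd, rfl⟩ := hy
      refine ⟨c + d, ?_, ?_⟩
      · intro z hz
        have := Finsupp.support_add hz
        rcases Finset.mem_union.1 this with h | h
        exacts [hc h, hd h]
      · rw [Finsupp.sum_add_index'] <;> simp [add_smul]

theorem eq_zero_of_multiset_sum_eq_zero (n : ℕ) : ∀ s : Multiset V, s.card = n →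
    (∀ α ∈ s, α ∈ R.Pos) → s.sum = 0 → s = 0 := by
  induction n with
  | zero => intro s hs _ _; exact Multiset.card_eq_zero.1 hs
  | succ n ih =>
    intro s hs hpos hsum
    exfalso
    obtain ⟨α, hαs⟩ := Multiset.card_pos_iff_exists_mem.1 (hs.symm ▸ Nat.succ_pos n : 0 < s.card)
    obtain ⟨t, rfl⟩ := Multiset.exists_cons_of_mem hαs
    have hα : α ∈ R.Pos := hpos α (Multiset.mem_cons_self _ _)
    rw [Multiset.sum_cons] at hsum
    have hαα := R.inner_self_pos (R.pos_subset hα)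
    have hneg : ⟪α, t.sum⟫_ℝ < 0 := by
      rw [eq_neg_of_add_eq_zero_right hsum]
      simpa only [inner_neg_right, neg_lt_zero] using hαα
    have hex : ∃ β ∈ t, ⟪α, β⟫_ℝ < 0 := by
      by_contra! hcon
      have : 0 ≤ ⟪α, t.sum⟫_ℝ := by
        have h1 : ⟪α, t.sum⟫_ℝ = (t.map fun β => ⟪α, β⟫_ℝ).sum :=
          map_multiset_sum (innerₛₗ ℝ α) t
        rw [h1]
        apply Multiset.sum_nonneg
        intro x hx
        obtain ⟨β, hβ, rfl⟩ := Multiset.mem_map.1 hx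
        exact hcon β hβ
      linarith
    obtain ⟨β, hβ, hαβ⟩ := hex
    obtain ⟨u, rfl⟩ := Multiset.exists_cons_of_mem hβ
    have hβp : β ∈ R.Pos := hpos β (by simp)
    have hne : α + β ≠ 0 := by
      intro h
      apply R.not_neg_mem β hβp
      rwa [← eq_neg_of_add_eq_zero_left h]
    have hadd := R.pos_add α hα β hβp
      (R.add_mem_of_inner_neg (R.pos_subset hα) (R.pos_subset hβp) hαβ hne)
    have := ih ((α + β) ::ₘ u) (by simpa using hs)
      (by
        intro γ hγ
        rcases Multiset.mem_cons.1 hγ with rfl | hγ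
        · exact hadd
        · exact hpos γ (by simp [hγ]))
      (by rw [Multiset.sum_cons, ← hsum, Multiset.sum_cons]; abel)
    exact Multiset.cons_ne_zero this

theorem posCone_eq_zero {x : V} (hx : x ∈ R.posCone) (hx' : -x ∈ R.posCone) : x = 0 := by
  obtain ⟨s, hs, rfl⟩ := AddSubmonoid.exists_multiset_of_mem_closure hx
  obtain ⟨t, ht, hst⟩ := AddSubmonoid.exists_multiset_of_mem_closure hx'
  have := R.eq_zero_of_multiset_sum_eq_zero _ (s + t) rfl
    (by
      intro α hα
      rcases Multiset.mem_add.1 hα with h | h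
      exacts [hs α h, ht α h])
    (by rw [Multiset.sum_add, hst]; simp)
  have hs0 : s = 0 := (add_eq_zero.1 this).1
  simp [hs0]

theorem neg_pos_notMem_posCone {α : V} (h : α ∈ R.Pos) : -α ∉ R.posCone := fun h' =>
  R.pos_ne_zero h (R.posCone_eq_zero (R.pos_mem_posCone h) h')

theorem simple_subset_pos : R.Simple ⊆ R.Pos := fun _ h => h.1

theorem simple_subset : R.Simple ⊆ R.Δ := fun _ h => R.pos_subset h.1

theorem pos_induction {P : V → Prop} (hs : ∀ α ∈ R.Simple, P α)
    (ha : ∀ β ∈ R.Pos, ∀ γ ∈ R.Pos, P β → P γ → P (β + γ)) : ∀ φ ∈ R.Pos, P φ := by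
  have key : ∀ n, ∀ φ ∈ R.Pos, {ψ ∈ R.Pos | φ - ψ ∈ R.posCone}.ncard = n → P φ := by
    intro n
    induction n using Nat.strong_induction_on with
    | _ n ih =>
      intro φ hφ hn
      by_cases hsim : φ ∈ R.Simple
      · exact hs φ hsim
      have hdec : ∃ β ∈ R.Pos, ∃ γ ∈ R.Pos, φ = β + γ := by
        by_contra h
        exact hsim ⟨hφ, h⟩
      obtain ⟨β, hβ, γ, hγ, rfl⟩ := hdec
      have hlt : ∀ β ∈ R.Pos, ∀ γ ∈ R.Pos, β + γ ∈ R.Pos →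
          {ψ ∈ R.Pos | β - ψ ∈ R.posCone}.ncard < {ψ ∈ R.Pos | β + γ - ψ ∈ R.posCone}.ncard := by
        intro β hβ γ hγ hβγ
        apply Set.ncard_lt_ncard _ (R.finite_pos.subset fun _ h => h.1)
        refine ⟨fun ψ hψ => ⟨hψ.1, ?_⟩, fun hsub => ?_⟩
        · have := AddSubmonoid.add_mem _ hψ.2 (R.pos_mem_posCone hγ)
          rwa [sub_add_eq_add_sub] at this
        · have := (hsub (show β + γ ∈ _ from ⟨hβγ, by simp⟩)).2
          exact R.neg_pos_notMem_posCone hγ (by simpa using this)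
      have h1 := hlt β hβ γ hγ hφ
      have h2 := hlt γ hγ β hβ (by rwa [add_comm])
      rw [add_comm γ β] at h2
      exact ha β hβ γ hγ (ih _ (hn ▸ h1) β hβ rfl) (ih _ (hn ▸ h2) γ hγ rfl)
  exact fun φ hφ => key _ φ hφ rfl

theorem sub_simple_mem_pos {α φ : V} (hα : α ∈ R.Simple) (hφ : φ ∈ R.Pos)
    (h : φ - α ∈ R.Δ) : φ - α ∈ R.Pos := by
  rcases R.mem_or_neg _ h with h | h
  · exact h
  · exact absurd ⟨φ, hφ, -(φ - α), h, by abel⟩ hα.2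

theorem inner_simple_nonpos {α β : V} (hα : α ∈ R.Simple) (hβ : β ∈ R.Simple) (hne : α ≠ β) :
    ⟪α, β⟫_ℝ ≤ 0 := by
  by_contra! h
  have h1 := R.sub_simple_mem_pos hβ hα.1
    (R.sub_mem_of_inner_pos (R.simple_subset hα) (R.simple_subset hβ) h hne)
  exact hα.2 ⟨β, hβ.1, α - β, h1, by abel⟩

theorem add_ne_nsmul_simple {α : V} (hα : α ∈ R.Simple) (n : ℕ) :
    ∀ β ∈ R.Pos, ∀ γ ∈ R.Pos, β ≠ α → γ ≠ α → β + γ ≠ (n : ℝ) • α := by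
  induction n with
  | zero =>
    intro β hβ γ hγ _ _ h
    apply R.not_neg_mem γ hγ
    rw [← eq_neg_of_add_eq_zero_left (by simpa using h)]
    exact hβ
  | succ n ih =>
    have key : ∀ β ∈ R.Pos, ∀ γ ∈ R.Pos, β ≠ α → γ ≠ α → 0 < ⟪β, α⟫_ℝ →
        β + γ ≠ ((n + 1 : ℕ) : ℝ) • α := by
      intro β hβ γ hγ hβα hγα hpos h
      have h1 := R.sub_simple_mem_pos hα hβ
        (R.sub_mem_of_inner_pos (R.pos_subset hβ) (R.simple_subset hα) hpos hβα)
      refine ih (β - α) h1 γ hγ ?_ hγα ?_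
      · intro h2
        have h3 : β = (2 : ℝ) • α := by rw [two_smul, ← sub_eq_iff_eq_add.1 h2]
        rcases R.reduced α (R.simple_subset hα) 2 (h3 ▸ R.pos_subset hβ) with h | h <;> norm_num at h
      · rw [sub_add_eq_add_sub, h]
        push_cast
        module
    intro β hβ γ hγ hβα hγα h
    have hsum : 0 < ⟪β, α⟫_ℝ + ⟪γ, α⟫_ℝ := by
      rw [← inner_add_left, h, real_inner_smul_left]
      have := R.inner_self_pos (R.simple_subset hα)
      positivity
    rcases lt_or_ge 0 ⟪β, α⟫_ℝ with h1 | h1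
    · exact key β hβ γ hγ hβα hγα h1 h
    · exact key γ hγ β hβ hγα hβα (by linarith) (by rwa [add_comm])

theorem reflectRoot_simple_mem_pos {α φ : V} (hα : α ∈ R.Simple) (hφ : φ ∈ R.Pos)
    (hne : φ ≠ α) : reflectRoot α φ ∈ R.Pos ∧ reflectRoot α φ ≠ α := by
  have hα0 := R.pos_ne_zero hα.1
  have hself : reflectRoot α α = -α := by
    have h : ⟪α, α⟫_ℝ ≠ 0 := inner_self_ne_zero.2 hα0
    rw [reflectRoot, mul_div_assoc, div_self h]
    module
  have hself' : reflectRoot α (-α) = α := by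
    rw [← hself, reflectRoot_reflectRoot hα0]
  constructor
  · rcases R.mem_or_neg _ (R.reflectRoot_mem (R.pos_subset hφ) (R.simple_subset hα)) with h | h
    · exact h
    exfalso
    obtain ⟨n, hn⟩ := R.crystal φ (R.pos_subset hφ) α (R.simple_subset hα)
    have hαα := R.inner_self_pos (R.simple_subset hα)
    have hr : reflectRoot α φ = φ - (n : ℝ) • α := by
      rw [reflectRoot, hn, mul_div_assoc, div_self hαα.ne', mul_one]
    obtain ⟨m, rfl | rfl⟩ := n.eq_nat_or_neg
    · refine R.add_ne_nsmul_simple hα m φ hφ _ h hne ?_ ?_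
      · intro h2
        apply hne
        rw [← reflectRoot_reflectRoot hα0 φ, neg_eq_iff_eq_neg.1 h2, hself']
      · rw [hr]; push_cast; abel
    · refine R.neg_pos_notMem_posCone hφ ?_
      have : -φ = -reflectRoot α φ + m • α := by
        rw [hr]
        push_cast
        rw [Nat.cast_smul_eq_nsmul ℝ m α |>.symm]
        module
      rw [this]
      exact AddSubmonoid.add_mem _ (R.pos_mem_posCone h)
        (AddSubmonoid.nsmul_mem _ (R.pos_mem_posCone hα.1) _)
  · intro h2
    apply R.not_neg_mem α hα.1
    have h3 := reflectRoot_reflectRoot hα0 φ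
    rw [h2, hself] at h3
    rwa [h3]

/-- The sum of the positive roots. -/
noncomputable def sumPos : V := ∑ φ ∈ R.finite_pos.toFinset, φ

theorem inner_sumPos_simple {α : V} (hα : α ∈ R.Simple) : 0 < ⟪R.sumPos, α⟫_ℝ := by
  classical
  have hmem : α ∈ R.finite_pos.toFinset := by simpa using hα.1
  have hα0 := R.pos_ne_zero hα.1
  have h0 : ∑ φ ∈ R.finite_pos.toFinset.erase α, ⟪φ, α⟫_ℝ = 0 := by
    refine Finset.sum_involution (fun φ _ => reflectRoot α φ) ?_ ?_ ?_ ?_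
    · intro φ _
      rw [inner_reflectRoot_self hα0]
      ring
    · intro φ _ h h'
      apply h
      have := inner_reflectRoot_self hα0 φ
      rw [h'] at this
      linarith
    · intro φ hφ
      simp only [Finset.mem_erase, Set.Finite.mem_toFinset] at hφ ⊢
      exact (R.reflectRoot_simple_mem_pos hα hφ.2 hφ.1).symm
    · intro φ _
      exact reflectRoot_reflectRoot hα0 φ
  rw [sumPos, sum_inner, ← Finset.add_sum_erase _ _ hmem, h0, add_zero]
  exact R.inner_self_pos (R.simple_subset hα)

theorem inner_sumPos_pos : ∀ φ ∈ R.Pos, 0 < ⟪R.sumPos, φ⟫_ℝ :=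
  R.pos_induction (fun _ h => R.inner_sumPos_simple h) fun _ _ _ _ h1 h2 => by
    rw [inner_add_right]; linarith

theorem inner_sumPos_nonneg {x : V} (hx : x ∈ R.posCone) : 0 ≤ ⟪R.sumPos, x⟫_ℝ := by
  induction hx using AddSubmonoid.closure_induction with
  | mem x hx => exact (R.inner_sumPos_pos x hx).le
  | zero => simp
  | add x y _ _ hx hy => rw [inner_add_right]; linarith

theorem eq_zero_of_inner_sumPos_nonpos {x : V} (hx : x ∈ R.posCone)
    (h : ⟪R.sumPos, x⟫_ℝ ≤ 0) : x = 0 := by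
  induction hx using AddSubmonoid.closure_induction with
  | mem x hx => exact absurd (R.inner_sumPos_pos x hx) h.not_gt
  | zero => rfl
  | add x y hx hy ihx ihy =>
    rw [inner_add_right] at h
    have h1 := R.inner_sumPos_nonneg hx
    have h2 := R.inner_sumPos_nonneg hy
    rw [ihx (by linarith), ihy (by linarith), add_zero]

theorem linearIndependent_simple : LinearIndependent ℝ ((↑) : R.Simple → V) := by
  refine LinearMap.BilinForm.linearIndependent_of_pairwise_le_zero (innerₗ V) ?_
    (innerₛₗ ℝ R.sumPos) _ (fun α => R.inner_sumPos_simple α.2) ?_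
  · intro x hx
    exact real_inner_self_pos.2 hx
  · intro α β hne
    exact R.inner_simple_nonpos α.2 β.2 (fun h => hne (Subtype.ext h))

theorem pos_mem_span_simple : ∀ φ ∈ R.Pos, φ ∈ Submodule.span ℝ R.Simple :=
  R.pos_induction (fun _ h => Submodule.subset_span h) fun _ _ _ _ h1 h2 =>
    Submodule.add_mem _ h1 h2

theorem mem_span_of_pos_mem_span {W : Submodule ℝ V} (h : ∀ φ ∈ R.Pos, φ ∈ W) {φ : V}
    (hφ : φ ∈ R.Δ) : φ ∈ W := by
  rcases R.mem_or_neg _ hφ with h' | h'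
  · exact h φ h'
  · simpa using W.neg_mem (h _ h')

theorem span_simple : Submodule.span ℝ R.Simple = ⊤ := by
  rw [eq_top_iff, ← R.span_top, Submodule.span_le]
  exact fun φ hφ => R.mem_span_of_pos_mem_span R.pos_mem_span_simple hφ

/-- The basis of simple roots. -/
noncomputable def simpleBasis : Module.Basis R.Simple ℝ V :=
  Module.Basis.mk R.linearIndependent_simple (by simp [R.span_simple])

@[simp]
theorem simpleBasis_apply (α : R.Simple) : R.simpleBasis α = α := by simp [simpleBasis]

/-- The coefficient of a simple root. -/
noncomputable def coef (α : R.Simple) : V →ₗ[ℝ] ℝ := R.simpleBasis.coord α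

theorem coef_self (α : R.Simple) : R.coef α α = 1 := by
  have := R.simpleBasis.coord_apply α (R.simpleBasis α)
  rwa [Module.Basis.repr_self, Finsupp.single_eq_same, simpleBasis_apply] at this

theorem coef_of_ne {α β : R.Simple} (h : α ≠ β) : R.coef α β = 0 := by
  have := R.simpleBasis.coord_apply α (R.simpleBasis β)
  rwa [Module.Basis.repr_self, Finsupp.single_eq_of_ne h, simpleBasis_apply] at this

theorem mem_span_iff_coef {J : Set V} (hJ : J ⊆ R.Simple) {x : V} :
    x ∈ Submodule.span ℝ J ↔ ∀ α : R.Simple, (α : V) ∉ J → R.coef α x = 0 := by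
  have h1 : J = R.simpleBasis '' {α | (α : V) ∈ J} := by
    ext y
    constructor
    · exact fun hy => ⟨⟨y, hJ hy⟩, hy, by simp⟩
    · rintro ⟨α, hα, rfl⟩; simpa using hα
  conv_lhs => rw [h1]
  rw [Module.Basis.mem_span_image]
  constructor
  · intro h α hα
    by_contra h'
    exact hα (h (by simpa [coef] using h'))
  · intro h α hα
    by_contra h'
    simp only [Finset.mem_coe, Finsupp.mem_support_iff] at hα
    exact hα (by simpa [coef] using h α h')

theorem coef_pos_nonneg : ∀ φ ∈ R.Pos, ∀ α, 0 ≤ R.coef α φ := by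
  refine R.pos_induction (fun β hβ α => ?_) fun β _ γ _ h1 h2 α => ?_
  · by_cases h : α = ⟨β, hβ⟩
    · subst h
      rw [R.coef_self ⟨β, hβ⟩]
      norm_num
    · exact (R.coef_of_ne h).ge
  · rw [map_add]
    exact add_nonneg (h1 α) (h2 α)

theorem coef_nonneg {x : V} (hx : x ∈ R.posCone) (α : R.Simple) : 0 ≤ R.coef α x := by
  induction hx using AddSubmonoid.closure_induction with
  | mem x hx => exact R.coef_pos_nonneg x hx α
  | zero => simp
  | add x y _ _ hx hy => rw [map_add]; exact add_nonneg hx hy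

theorem finite_simple : R.Simple.Finite := R.finite_pos.subset R.simple_subset_pos

noncomputable instance : Fintype R.Simple := R.finite_simple.fintype

theorem sum_coef (x : V) : ∑ α : R.Simple, R.coef α x • (α : V) = x := by
  have := R.simpleBasis.sum_repr x
  simpa [coef] using this

theorem inner_eq_sum_coef (x y : V) :
    ⟪x, y⟫_ℝ = ∑ α : R.Simple, R.coef α x * ⟪(α : V), y⟫_ℝ := by
  conv_lhs => rw [← R.sum_coef x]
  simp [sum_inner, real_inner_smul_left]

/-- The roots lying in the span of `J`. -/
def rootsIn (J : Set V) : Set V := {φ ∈ R.Δ | φ ∈ Submodule.span ℝ J}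

theorem neg_mem_rootsIn {J : Set V} {φ : V} (h : φ ∈ R.rootsIn J) : -φ ∈ R.rootsIn J :=
  ⟨R.neg_mem _ h.1, Submodule.neg_mem _ h.2⟩

/-- `β` is maximal in `S` for the partial order defined by the positive cone. -/
def IsMaximalIn (S : Set V) (β : V) : Prop :=
  β ∈ S ∧ ∀ γ ∈ S, γ - β ∈ R.posCone → γ = β

variable {R}

theorem IsHighest.sub_mem_posCone {S : Set V} {β ψ : V} (h : R.IsHighest S β) (hψ : ψ ∈ S) :
    β - ψ ∈ R.posCone :=
  R.nonnegComb_iff.1 (h.2.2 ψ hψ)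

theorem IsHighest.isMaximalIn {S : Set V} {β : V} (h : R.IsHighest S β) : R.IsMaximalIn S β := by
  refine ⟨h.1, fun γ hγ hγβ => sub_eq_zero.1 (R.posCone_eq_zero hγβ ?_)⟩
  simpa using h.sub_mem_posCone hγ

theorem IsHighest.unique {S : Set V} {β γ : V} (hβ : R.IsHighest S β) (hγ : R.IsHighest S γ) :
    β = γ :=
  hγ.isMaximalIn.2 β hβ.1 (hβ.sub_mem_posCone hγ.1)

theorem IsMaximalIn.pos {J : Set V} {β : V} (h : R.IsMaximalIn (R.rootsIn J) β) : β ∈ R.Pos := by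
  rcases R.mem_or_neg _ h.1.1 with h' | h'
  · exact h'
  exfalso
  have h1 := h.2 (-β) (R.neg_mem_rootsIn h.1)
    (by
      have := AddSubmonoid.add_mem _ (R.pos_mem_posCone h') (R.pos_mem_posCone h')
      rwa [← sub_eq_add_neg] at this)
  exact R.not_neg_mem (-β) h' (by rwa [neg_neg, ← h1])

theorem IsMaximalIn.inner_nonneg {J : Set V} {β ψ : V} (h : R.IsMaximalIn (R.rootsIn J) β)
    (hψ : ψ ∈ R.rootsIn J) (hψp : ψ ∈ R.Pos) : 0 ≤ ⟪ψ, β⟫_ℝ := by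
  by_contra! hneg
  have hne : ψ + β ≠ 0 := by
    intro h0
    apply R.not_neg_mem β h.pos
    rwa [← eq_neg_of_add_eq_zero_left h0]
  have hmem : ψ + β ∈ R.rootsIn J :=
    ⟨R.add_mem_of_inner_neg hψ.1 h.1.1 hneg hne, Submodule.add_mem _ hψ.2 h.1.2⟩
  have := h.2 _ hmem (by simpa using R.pos_mem_posCone hψp)
  exact R.pos_ne_zero hψp (by simpa using this)

variable (R)

theorem exists_isMaximalIn {S : Set V} (hS : S ⊆ R.Δ) {φ : V} (hφ : φ ∈ S) :
    ∃ β, R.IsMaximalIn S β ∧ β - φ ∈ R.posCone := by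
  obtain ⟨β, hβ, hmax⟩ := Set.exists_max_image {β ∈ S | β - φ ∈ R.posCone}
    (fun β => ⟪R.sumPos, β⟫_ℝ) (R.finite.subset fun _ h => hS h.1)
    ⟨φ, hφ, by simp⟩
  refine ⟨β, ⟨hβ.1, fun γ hγ hγβ => sub_eq_zero.1 (R.eq_zero_of_inner_sumPos_nonpos hγβ ?_)⟩, hβ.2⟩
  have := hmax γ ⟨hγ, by simpa using AddSubmonoid.add_mem _ hγβ hβ.2⟩
  rw [inner_sub_right]
  linarith

variable {R}

theorem IsMaximalIn.inner_eq_zero {J : Set V} {β γ : V} (hβ : R.IsMaximalIn (R.rootsIn J) β)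
    (hγ : R.IsMaximalIn (R.rootsIn J) γ) (hne : γ ≠ β) : ⟪β, γ⟫_ℝ = 0 := by
  refine le_antisymm ?_ (hγ.inner_nonneg hβ.1 hβ.pos)
  by_contra! hpos
  have hmem := R.sub_mem_of_inner_pos hβ.1.1 hγ.1.1 hpos hne.symm
  rcases R.mem_or_neg _ hmem with h | h
  · exact hne (hγ.2 β hβ.1 (R.pos_mem_posCone h)).symm
  · exact hne (hβ.2 γ hγ.1 (by simpa using R.pos_mem_posCone h))

variable (R)

theorem simple_mem_rootsIn {J : Set V} (hJ : J ⊆ R.Simple) {α : V} (hα : α ∈ J) :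
    α ∈ R.rootsIn J :=
  ⟨R.simple_subset (hJ hα), Submodule.subset_span hα⟩

theorem inner_coef_of_maximal {J : Set V} (hJ : J ⊆ R.Simple) {β : V}
    (h : R.IsMaximalIn (R.rootsIn J) β) {x : V} (hx : x ∈ R.rootsIn J) (hxp : x ∈ R.Pos)
    (h0 : ⟪x, β⟫_ℝ = 0) (α : R.Simple) (hα : R.coef α x ≠ 0) : ⟪(α : V), β⟫_ℝ = 0 := by
  rw [R.inner_eq_sum_coef] at h0
  have hJmem : ∀ α : R.Simple, R.coef α x ≠ 0 → (α : V) ∈ J := by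
    intro α hα
    by_contra hn
    exact hα ((R.mem_span_iff_coef hJ).1 hx.2 α hn)
  have hnn : ∀ α ∈ Finset.univ, 0 ≤ R.coef α x * ⟪(α : V), β⟫_ℝ := by
    intro α _
    by_cases hα : R.coef α x = 0
    · simp [hα]
    · exact mul_nonneg (R.coef_pos_nonneg x hxp α)
        (h.inner_nonneg (R.simple_mem_rootsIn hJ (hJmem α hα)) α.2.1)
  have := (Finset.sum_eq_zero_iff_of_nonneg hnn).1 h0 α (Finset.mem_univ _)
  exact (mul_eq_zero.1 this).resolve_left hα

theorem exists_isHighest {J : Set V} (hJ : J ⊆ R.Simple) (hirr : IsIrred (R.rootsIn J)) :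
    ∃ β, R.IsHighest (R.rootsIn J) β := by
  obtain ⟨⟨φ₀, hφ₀⟩, hirr⟩ := hirr
  obtain ⟨β, hβ, -⟩ := R.exists_isMaximalIn (fun _ h => h.1) hφ₀
  have hβp := hβ.pos
  set J₁ : Set V := {α | ∃ h : α ∈ R.Simple, R.coef ⟨α, h⟩ β ≠ 0} with hJ₁
  have hJ₁s : J₁ ⊆ R.Simple := fun α h => h.1
  have hJ₁J : J₁ ⊆ J := by
    rintro α ⟨hα, h⟩
    by_contra hn
    exact h ((R.mem_span_iff_coef hJ).1 hβ.1.2 ⟨α, hα⟩ hn)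
  have hJ₂s : J \ J₁ ⊆ R.Simple := fun α h => hJ h.1
  have hβJ₁ : β ∈ Submodule.span ℝ J₁ := by
    rw [R.mem_span_iff_coef hJ₁s]
    intro α hα
    by_contra hn
    exact hα ⟨α.2, hn⟩
  have horth : ∀ γ ∈ J₁, ∀ α ∈ J \ J₁, ⟪γ, α⟫_ℝ = 0 := by
    rintro γ ⟨hγ, hγc⟩ α ⟨hα, hαn⟩
    have h1 : 0 ≤ ⟪α, β⟫_ℝ := hβ.inner_nonneg (R.simple_mem_rootsIn hJ hα) (hJ hα).1
    have hnp : ∀ δ ∈ Finset.univ, R.coef δ β * ⟪(δ : V), α⟫_ℝ ≤ 0 := by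
      intro δ _
      by_cases hδ : (δ : V) = α
      · have : R.coef δ β = 0 := by
          by_contra hn
          exact hαn ⟨hJ hα, by simpa [← hδ] using hn⟩
        simp [this]
      · exact mul_nonpos_of_nonneg_of_nonpos (R.coef_pos_nonneg β hβp δ)
          (R.inner_simple_nonpos δ.2 (hJ hα) hδ)
    have h2 : ∑ δ : R.Simple, R.coef δ β * ⟪(δ : V), α⟫_ℝ = 0 := by
      refine le_antisymm (Finset.sum_nonpos hnp) ?_
      rw [← R.inner_eq_sum_coef, real_inner_comm]
      exact h1
    have := (Finset.sum_eq_zero_iff_of_nonpos hnp).1 h2 ⟨γ, hγ⟩ (Finset.mem_univ _)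
    exact (mul_eq_zero.1 this).resolve_left hγc
  have hother : ∀ γ, R.IsMaximalIn (R.rootsIn J) γ → γ ≠ β → γ ∈ Submodule.span ℝ (J \ J₁) := by
    intro γ hγ hne
    have h0 : ⟪β, γ⟫_ℝ = 0 := hβ.inner_eq_zero hγ hne
    have hJ₁γ : ∀ α ∈ J₁, ⟪α, γ⟫_ℝ = 0 := fun α hα =>
      R.inner_coef_of_maximal hJ hγ hβ.1 hβp h0 ⟨α, hα.1⟩ hα.2
    have hsplit : γ ∈ Submodule.span ℝ J₁ ⊔ Submodule.span ℝ (J \ J₁) := by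
      rw [← Submodule.span_union, Set.union_sdiff_cancel hJ₁J]
      exact hγ.1.2
    obtain ⟨a, ha, b, hb, rfl⟩ := Submodule.mem_sup.1 hsplit
    have h1 : ⟪a, a + b⟫_ℝ = 0 := inner_eq_zero_of_mem_span (B := {a + b})
      (by simpa using hJ₁γ) ha (Submodule.mem_span_singleton_self _)
    rw [inner_add_right, inner_eq_zero_of_mem_span horth ha hb, add_zero] at h1
    rw [inner_self_eq_zero.1 h1, zero_add]
    exact hb
  have hpos : ∀ ψ ∈ R.rootsIn J, ψ ∈ R.Pos →
      (β - ψ ∈ R.posCone ∧ ψ ∈ Submodule.span ℝ J₁) ∨ ψ ∈ Submodule.span ℝ (J \ J₁) := by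
    intro ψ hψ hψp
    obtain ⟨γ, hγ, hγψ⟩ := R.exists_isMaximalIn (fun _ h => h.1) hψ
    have hle : ∀ α, R.coef α ψ ≤ R.coef α γ := fun α => by
      simpa using R.coef_nonneg hγψ α
    have hmono : ∀ K ⊆ R.Simple, γ ∈ Submodule.span ℝ K → ψ ∈ Submodule.span ℝ K := by
      intro K hK hγK
      rw [R.mem_span_iff_coef hK] at hγK ⊢
      intro α hα
      exact le_antisymm (hγK α hα ▸ hle α) (R.coef_pos_nonneg ψ hψp α)
    by_cases hγβ : γ = β
    · subst hγβ
      exact Or.inl ⟨hγψ, hmono _ hJ₁s hβJ₁⟩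
    · exact Or.inr (hmono _ hJ₂s (hother γ hγ hγβ))
  have hdisj : ∀ ψ ∈ R.Δ, ψ ∈ Submodule.span ℝ J₁ → ψ ∉ Submodule.span ℝ (J \ J₁) :=
    fun ψ hψ h1 h2 => R.ne_zero hψ (inner_self_eq_zero.1 (inner_eq_zero_of_mem_span horth h1 h2))
  have hempty : ∀ ψ ∈ R.rootsIn J, ψ ∉ Submodule.span ℝ (J \ J₁) := by
    intro ψ hψ hψ₂
    apply hirr
    refine ⟨{ψ ∈ R.rootsIn J | ψ ∈ Submodule.span ℝ J₁},
      {ψ ∈ R.rootsIn J | ψ ∈ Submodule.span ℝ (J \ J₁)}, ?_, ?_, ⟨β, hβ.1, hβJ₁⟩, ⟨ψ, hψ, hψ₂⟩,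
      fun a ha b hb => inner_eq_zero_of_mem_span horth ha.2 hb.2⟩
    · ext χ
      constructor
      · rintro (h | h) <;> exact h.1
      · intro hχ
        rcases R.mem_or_neg χ hχ.1 with hp | hp
        · rcases hpos χ hχ hp with h | h
          exacts [Or.inl ⟨hχ, h.2⟩, Or.inr ⟨hχ, h⟩]
        · rcases hpos _ (R.neg_mem_rootsIn hχ) hp with h | h
          exacts [Or.inl ⟨hχ, by simpa using h.2⟩, Or.inr ⟨hχ, by simpa using h⟩]
    · ext χ
      simp only [Set.mem_inter_iff, Set.mem_ofPred_eq, Set.mem_empty_iff_false, iff_false]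
      exact fun h => hdisj χ h.1.1.1 h.1.2 h.2.2
  refine ⟨β, hβ.1, hβp, fun ψ hψ => R.nonnegComb_iff.2 ?_⟩
  rcases R.mem_or_neg ψ hψ.1 with hp | hp
  · exact ((hpos ψ hψ hp).resolve_right (hempty ψ hψ)).1
  · rw [sub_eq_add_neg]
    exact AddSubmonoid.add_mem _ (R.pos_mem_posCone hβp) (R.pos_mem_posCone hp)

theorem mem_span_sdiff_singleton_iff (α : R.Simple) (x : V) :
    x ∈ Submodule.span ℝ (R.Simple \ {(α : V)}) ↔ R.coef α x = 0 := by
  rw [R.mem_span_iff_coef Set.sdiff_subset]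
  constructor
  · exact fun h => h α (by simp)
  · intro h γ hγ
    have : γ = α := by
      by_contra hne
      exact hγ ⟨γ.2, fun h' => hne (Subtype.ext h')⟩
    rwa [this]

variable {R}

theorem IsHighest.support_eq {J : Set V} (hJ : J ⊆ R.Simple) {β : V}
    (h : R.IsHighest (R.rootsIn J) β) : R.support β = J := by
  ext α
  constructor
  · rintro ⟨hα, hn⟩
    by_contra hαJ
    exact hn ((R.mem_span_sdiff_singleton_iff ⟨α, hα⟩ β).2
      ((R.mem_span_iff_coef hJ).1 h.1.2 ⟨α, hα⟩ hαJ))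
  · intro hα
    refine ⟨hJ hα, fun hn => ?_⟩
    have h1 := (R.mem_span_sdiff_singleton_iff ⟨α, hJ hα⟩ β).1 hn
    have h2 := R.coef_nonneg (h.sub_mem_posCone (R.simple_mem_rootsIn hJ hα)) ⟨α, hJ hα⟩
    rw [map_sub, h1, R.coef_self ⟨α, hJ hα⟩] at h2
    norm_num at h2

theorem IsHighest.sub_eq {J : Set V} (hJ : J ⊆ R.Simple) {β : V}
    (h : R.IsHighest (R.rootsIn J) β) : R.sub β = R.rootsIn J := by
  rw [← h.support_eq hJ]
  rfl

theorem IsHighest.orth_eq {J : Set V} (hJ : J ⊆ R.Simple) {β : V}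
    (h : R.IsHighest (R.rootsIn J) β) : R.orth β = R.rootsIn {α ∈ J | ⟪α, β⟫_ℝ = 0} := by
  have hJ' : {α ∈ J | ⟪α, β⟫_ℝ = 0} ⊆ R.Simple := fun α hα => hJ hα.1
  have hpos : ∀ φ ∈ R.rootsIn J, φ ∈ R.Pos → ⟪φ, β⟫_ℝ = 0 →
      φ ∈ Submodule.span ℝ {α ∈ J | ⟪α, β⟫_ℝ = 0} := by
    intro φ hφ hφp h0
    rw [R.mem_span_iff_coef hJ']
    intro α hα
    by_contra hn
    refine hα ⟨?_, R.inner_coef_of_maximal hJ h.isMaximalIn hφ hφp h0 α hn⟩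
    by_contra hαJ
    exact hn ((R.mem_span_iff_coef hJ).1 hφ.2 α hαJ)
  ext φ
  rw [orth, h.sub_eq hJ]
  constructor
  · rintro ⟨hφ, h0⟩
    refine ⟨hφ.1, ?_⟩
    rcases R.mem_or_neg φ hφ.1 with hp | hp
    · exact hpos φ hφ hp h0
    · simpa using hpos _ (R.neg_mem_rootsIn hφ) hp (by simpa using h0)
  · rintro ⟨hφ, hs⟩
    refine ⟨⟨hφ, Submodule.span_mono (fun α hα => hα.1) hs⟩, ?_⟩
    exact inner_eq_zero_of_mem_span (B := {β}) (by simp) hs (Submodule.mem_span_singleton_self β)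

variable (R)

theorem component_eq_rootsIn {J : Set V} (hJ : J ⊆ R.Simple) {C : Set V}
    (h : IsComponent (R.rootsIn J) C) : C = R.rootsIn (J ∩ C) := by
  have horth : ∀ φ ∈ C, ∀ y ∈ Submodule.span ℝ (J \ C), ⟪φ, y⟫_ℝ = 0 := fun φ hφ y hy =>
    inner_eq_zero_of_mem_span (A := {φ}) (B := J \ C)
      (by
        rintro _ rfl b hb
        exact h.2.2 _ hφ b ⟨R.simple_mem_rootsIn hJ hb.1, hb.2⟩)
      (Submodule.mem_span_singleton_self φ) hy
  ext φ
  constructor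
  · intro hφ
    refine ⟨(h.1 hφ).1, ?_⟩
    have hsplit : φ ∈ Submodule.span ℝ (J ∩ C) ⊔ Submodule.span ℝ (J \ C) := by
      rw [← Submodule.span_union, Set.inter_union_sdiff]
      exact (h.1 hφ).2
    obtain ⟨a, ha, b, hb, rfl⟩ := Submodule.mem_sup.1 hsplit
    have h1 := horth _ hφ b hb
    rw [inner_add_left, inner_eq_zero_of_mem_span
      (fun x hx y hy => horth x hx.2 y (Submodule.subset_span hy)) ha hb, zero_add] at h1
    rw [inner_self_eq_zero.1 h1, add_zero]
    exact ha
  · rintro ⟨hφ, hs⟩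
    by_contra hn
    have hφS : φ ∈ R.rootsIn J := ⟨hφ, Submodule.span_mono Set.inter_subset_left hs⟩
    have : ⟪φ, φ⟫_ℝ = 0 := inner_eq_zero_of_mem_span (A := J ∩ C) (B := {φ})
      (by
        rintro a ha _ rfl
        exact h.2.2 a ha.2 _ ⟨hφS, hn⟩) hs (Submodule.mem_span_singleton_self φ)
    exact R.ne_zero hφ (inner_self_eq_zero.1 this)

end RootSystemData

section Components

variable {V : Type*} [NormedAddCommGroup V] [InnerProductSpace ℝ V]

theorem IsIrred.subset_or_inner_eq_zero {S C C' : Set V} (h : IsIrred C') (hC : IsComponent S C)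
    (hsub : C' ⊆ S) : C' ⊆ C ∨ ∀ a ∈ C, ∀ b ∈ C', ⟪a, b⟫_ℝ = 0 := by
  by_cases h1 : (C' \ C).Nonempty
  · right
    have h2 : ¬ (C' ∩ C).Nonempty := fun h2 =>
      h.2 ⟨C' ∩ C, C' \ C, Set.inter_union_sdiff _ _, Set.disjoint_sdiff_inter.symm.inter_eq, h2, h1,
        fun a ha b hb => hC.2.2 a ha.2 b ⟨hsub hb.1, hb.2⟩⟩
    exact fun a ha b hb => hC.2.2 a ha b ⟨hsub hb, fun hbC => h2 ⟨b, hb, hbC⟩⟩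
  · left
    exact Set.sdiff_eq_empty.1 (Set.not_nonempty_iff_eq_empty.1 h1)

theorem exists_isComponent_mem {S : Set V} {φ : V} (hφ : φ ∈ S) :
    ∃ C, IsComponent S C ∧ φ ∈ C := by
  set C : Set V := {ψ | Relation.ReflTransGen (fun a b => b ∈ S ∧ ⟪a, b⟫_ℝ ≠ 0) φ ψ} with hCdef
  have hCS : C ⊆ S := by
    intro ψ hψ
    rcases Relation.ReflTransGen.cases_tail hψ with h | ⟨_, _, h⟩
    exacts [h ▸ hφ, h.1]
  have hφC : φ ∈ C := Relation.ReflTransGen.refl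
  have hclosed : ∀ A B : Set V, A ∪ B = C → φ ∈ A → (∀ a ∈ A, ∀ b ∈ B, ⟪a, b⟫_ℝ = 0) →
      C ⊆ A := by
    intro A B hAB hφA horth ψ hψ
    induction hψ with
    | refl => exact hφA
    | tail hab hbc ih =>
      rename_i b c
      have hc : c ∈ A ∪ B := hAB ▸ Relation.ReflTransGen.tail hab hbc
      exact hc.resolve_right fun hcB => hbc.2 (horth b ih c hcB)
  refine ⟨C, ⟨hCS, ⟨⟨φ, hφC⟩, ?_⟩, ?_⟩, hφC⟩
  · rintro ⟨A, B, hAB, hdisj, ⟨a, ha⟩, ⟨b, hb⟩, horth⟩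
    have haC : a ∈ C := hAB ▸ Set.mem_union_left B ha
    have hbC : b ∈ C := hAB ▸ Set.mem_union_right A hb
    rcases (hAB ▸ hφC : φ ∈ A ∪ B) with h | h
    · have := hclosed A B hAB h horth hbC
      exact Set.notMem_empty b (hdisj ▸ ⟨this, hb⟩)
    · have := hclosed B A (by rwa [Set.union_comm]) h
        (fun x hx y hy => by rw [real_inner_comm]; exact horth y hy x hx) haC
      exact Set.notMem_empty a (hdisj ▸ ⟨ha, this⟩)
  · intro a ha b hb
    by_contra hne
    exact hb.2 (Relation.ReflTransGen.tail ha ⟨hb.1, hne⟩)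

end Components

namespace RootSystemData

variable {V : Type*} [NormedAddCommGroup V] [InnerProductSpace ℝ V] (R : RootSystemData V)

/-- The pairs consisting of an irreducible subsystem occurring in the construction of the cascade
and its highest root. -/
inductive IsNode : Set V → V → Prop
  | root {C : Set V} {β : V} : IsComponent R.Δ C → R.IsHighest C β → IsNode C β
  | child {C C' : Set V} {β β' : V} : IsNode C β → IsComponent (R.orth β) C' →
      R.IsHighest C' β' → IsNode C' β'

theorem roots_eq_rootsIn : R.Δ = R.rootsIn R.Simple := by
  simp [rootsIn, R.span_simple]

variable {R}

theorem IsNode.isHighest {C : Set V} {β : V} (h : R.IsNode C β) : R.IsHighest C β := by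
  cases h <;> assumption

theorem IsNode.isIrred {C : Set V} {β : V} (h : R.IsNode C β) : IsIrred C := by
  cases h with
  | root h _ => exact h.2.1
  | child _ h _ => exact h.2.1

theorem IsNode.exists_eq_rootsIn {C : Set V} {β : V} (h : R.IsNode C β) :
    ∃ J ⊆ R.Simple, C = R.rootsIn J := by
  induction h with
  | root hC _ =>
    rw [R.roots_eq_rootsIn] at hC
    exact ⟨_, Set.inter_subset_left, R.component_eq_rootsIn subset_rfl hC⟩
  | child h hC _ ih =>
    obtain ⟨J, hJ, rfl⟩ := ih
    rw [h.isHighest.orth_eq hJ] at hC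
    have hJ' : ∀ β, {α ∈ J | ⟪α, β⟫_ℝ = 0} ⊆ R.Simple := fun _ α hα => hJ hα.1
    exact ⟨_, Set.inter_subset_left.trans (hJ' _), R.component_eq_rootsIn (hJ' _) hC⟩

theorem IsNode.sub_eq {C : Set V} {β : V} (h : R.IsNode C β) : R.sub β = C := by
  obtain ⟨J, hJ, rfl⟩ := h.exists_eq_rootsIn
  exact h.isHighest.sub_eq hJ

theorem IsNode.orth_subset {C : Set V} {β : V} (h : R.IsNode C β) : R.orth β ⊆ C := by
  rw [← h.sub_eq]
  exact fun _ h => h.1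

theorem IsNode.subset_roots {C : Set V} {β : V} (h : R.IsNode C β) : C ⊆ R.Δ := by
  rw [← h.sub_eq]
  exact fun _ h => h.1

theorem IsNode.inner_nonneg {C : Set V} {β ψ : V} (h : R.IsNode C β) (hψ : ψ ∈ C)
    (hψp : ψ ∈ R.Pos) : 0 ≤ ⟪ψ, β⟫_ℝ := by
  obtain ⟨J, hJ, rfl⟩ := h.exists_eq_rootsIn
  exact h.isHighest.isMaximalIn.inner_nonneg hψ hψp

theorem IsNode.eq_or_inner_eq_zero {S C C' : Set V} {β' : V} (hC : IsComponent S C)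
    (h' : R.IsNode C' β') (hsub : C' ⊆ S) (hCC' : C ⊆ C') :
    C' = C ∨ ∀ a ∈ C, ∀ b ∈ C', ⟪a, b⟫_ℝ = 0 :=
  (h'.isIrred.subset_or_inner_eq_zero hC hsub).imp_left (Set.Subset.antisymm · hCC')

/-- Two nodes are equal, nested below the orthogonal complement of a highest root, or
orthogonal. -/
theorem IsNode.relation {C : Set V} {β : V} (h : R.IsNode C β) :
    ∀ {C' : Set V} {β' : V}, R.IsNode C' β' →
      C' = C ∨ C' ⊆ R.orth β ∨ C ⊆ R.orth β' ∨ ∀ a ∈ C, ∀ b ∈ C', ⟪a, b⟫_ℝ = 0 := by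
  induction h with
  | @root C β hC hβ =>
    intro C' β' h'
    have hn : R.IsNode C β := .root hC hβ
    induction h' with
    | root hC' hβ' =>
      rcases hn.isIrred.subset_or_inner_eq_zero hC' hn.subset_roots with h1 | h1
      · rcases IsNode.eq_or_inner_eq_zero hC (.root hC' hβ') (hC'.1) h1 with h | h
        exacts [Or.inl h, Or.inr (Or.inr (Or.inr h))]
      · exact Or.inr (Or.inr (Or.inr fun a ha b hb => by rw [real_inner_comm]; exact h1 b hb a ha))
    | child hD hC' hβ' ih =>
      have hn' := hD.child hC' hβ'
      rcases ih with rfl | h1 | h1 | h1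
      · have := hD.isHighest.unique hn.isHighest
        exact Or.inr (Or.inl (this ▸ hC'.1))
      · exact Or.inr (Or.inl ((hC'.1.trans hD.orth_subset).trans h1))
      · rcases hn.isIrred.subset_or_inner_eq_zero hC' h1 with h2 | h2
        · rcases IsNode.eq_or_inner_eq_zero hC hn' hn'.subset_roots h2 with h | h
          exacts [Or.inl h, Or.inr (Or.inr (Or.inr h))]
        · exact Or.inr (Or.inr (Or.inr fun a ha b hb => by
            rw [real_inner_comm]; exact h2 b hb a ha))
      · exact Or.inr (Or.inr (Or.inr fun a ha b hb => h1 a ha b (hD.orth_subset (hC'.1 hb))))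
  | @child E C ε β hE hC hβ ihE =>
    intro C' β' h'
    have hn : R.IsNode C β := .child hE hC hβ
    have hCE : C ⊆ E := hC.1.trans hE.orth_subset
    have key : ∀ {C' : Set V} {β' : V}, R.IsNode C' β' → C ⊆ C' →
        C' = C ∨ C' ⊆ R.orth β ∨ C ⊆ R.orth β' ∨ ∀ a ∈ C, ∀ b ∈ C', ⟪a, b⟫_ℝ = 0 := by
      intro C' β' hn' hCC'
      rcases ihE hn' with rfl | h1 | h1 | h1
      · have : β' = ε := hn'.isHighest.unique hE.isHighest
        exact Or.inr (Or.inr (Or.inl (this ▸ hC.1)))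
      · rcases IsNode.eq_or_inner_eq_zero hC hn' h1 hCC' with h | h
        exacts [Or.inl h, Or.inr (Or.inr (Or.inr h))]
      · exact Or.inr (Or.inr (Or.inl (hCE.trans h1)))
      · exact Or.inr (Or.inr (Or.inr fun a ha b hb => h1 a (hCE ha) b hb))
    induction h' with
    | root hC' hβ' =>
      rcases hn.isIrred.subset_or_inner_eq_zero hC' hn.subset_roots with h1 | h1
      · exact key (.root hC' hβ') h1
      · exact Or.inr (Or.inr (Or.inr fun a ha b hb => by rw [real_inner_comm]; exact h1 b hb a ha))
    | child hD hC' hβ' ih =>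
      have hn' := hD.child hC' hβ'
      rcases ih with rfl | h1 | h1 | h1
      · have := hD.isHighest.unique hn.isHighest
        exact Or.inr (Or.inl (this ▸ hC'.1))
      · exact Or.inr (Or.inl ((hC'.1.trans hD.orth_subset).trans h1))
      · rcases hn.isIrred.subset_or_inner_eq_zero hC' h1 with h2 | h2
        · exact key hn' h2
        · exact Or.inr (Or.inr (Or.inr fun a ha b hb => by
            rw [real_inner_comm]; exact h2 b hb a ha))
      · exact Or.inr (Or.inr (Or.inr fun a ha b hb => h1 a ha b (hD.orth_subset (hC'.1 hb))))

variable (R)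

theorem exists_isNode_inner_pos {φ : V} (hφ : φ ∈ R.Pos) :
    ∃ C β, R.IsNode C β ∧ φ ∈ C ∧ 0 < ⟪φ, β⟫_ℝ := by
  have key : ∀ n, ∀ C β, R.IsNode C β → φ ∈ C → C.ncard = n →
      ∃ C β, R.IsNode C β ∧ φ ∈ C ∧ 0 < ⟪φ, β⟫_ℝ := by
    intro n
    induction n using Nat.strong_induction_on with
    | _ n ih =>
      intro C β h hφC hn
      rcases (h.inner_nonneg hφC hφ).lt_or_eq with hpos | h0
      · exact ⟨C, β, h, hφC, hpos⟩
      obtain ⟨J, hJ, rfl⟩ := h.exists_eq_rootsIn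
      have hφo : φ ∈ R.orth β := ⟨h.sub_eq ▸ hφC, h0.symm⟩
      obtain ⟨C', hC', hφC'⟩ := exists_isComponent_mem hφo
      have hJ' : {α ∈ J | ⟪α, β⟫_ℝ = 0} ⊆ R.Simple := fun α hα => hJ hα.1
      have hC'' := hC'
      rw [h.isHighest.orth_eq hJ] at hC''
      have heq := R.component_eq_rootsIn hJ' hC''
      have hirr := hC'.2.1
      rw [heq] at hirr
      obtain ⟨β', hβ'⟩ := R.exists_isHighest (Set.inter_subset_left.trans hJ') hirr
      rw [← heq] at hβ'
      refine ih _ ?_ C' β' (h.child hC' hβ') hφC' rfl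
      rw [← hn]
      refine Set.ncard_lt_ncard ⟨hC'.1.trans h.orth_subset, fun hsub => ?_⟩
        (R.finite.subset h.subset_roots)
      have := (hC'.1 (hsub h.isHighest.1)).2
      exact R.pos_ne_zero h.isHighest.2.1 (inner_self_eq_zero.1 this)
  obtain ⟨C, hC, hφC⟩ := exists_isComponent_mem (R.pos_subset hφ)
  have hC' := hC
  rw [R.roots_eq_rootsIn] at hC'
  have heq := R.component_eq_rootsIn subset_rfl hC'
  have hirr := hC.2.1
  rw [heq] at hirr
  obtain ⟨β, hβ⟩ := R.exists_isHighest Set.inter_subset_left hirr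
  rw [← heq] at hβ
  exact key _ C β (.root hC hβ) hφC rfl

theorem mem_cascade_iff {β : V} : β ∈ R.cascade ↔ R.IsNode (R.sub β) β := by
  constructor
  · rintro ⟨l, ⟨-, hhead, hchain⟩, hβ⟩
    have key : ∀ l : List V,
        l.IsChain (fun γ δ => ∃ C, IsComponent (R.orth γ) C ∧ R.IsHighest C δ) →
        (∀ b ∈ l.head?, ∃ C, R.IsNode C b) → ∀ b ∈ l, ∃ C, R.IsNode C b := by
      intro l
      induction l with
      | nil => simp
      | cons a l ih =>
        intro hl hh b hb
        rw [List.isChain_cons] at hl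
        obtain ⟨C, hC⟩ := hh a (by simp)
        rcases List.mem_cons.1 hb with rfl | hb
        · exact ⟨C, hC⟩
        · refine ih hl.2 (fun c hc => ?_) b hb
          obtain ⟨C', hC', hc'⟩ := hl.1 c hc
          exact ⟨C', hC.child hC' hc'⟩
    obtain ⟨C, hC⟩ := key l hchain
      (fun b hb => (hhead b hb).imp fun C h => .root h.1 h.2) β hβ
    rwa [hC.sub_eq]
  · intro h
    have key : ∀ C β, R.IsNode C β → ∃ l, R.IsChainCascade (l ++ [β]) := by
      intro C β h
      induction h with
      | @root C β hC hβ => exact ⟨[], by simp, by simpa using ⟨C, hC, hβ⟩, List.isChain_singleton _⟩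
      | @child C C' β β' h hC' hβ' ih =>
        obtain ⟨l, hne, hhead, hchain⟩ := ih
        refine ⟨l ++ [β], by simp, ?_, ?_⟩
        · rwa [List.head?_append_of_ne_nil _ hne]
        · refine List.isChain_append.2 ⟨hchain, List.isChain_singleton _, ?_⟩
          simpa using ⟨C', hC', hβ'⟩
    obtain ⟨l, hl⟩ := key _ β h
    exact ⟨_, hl, by simp⟩

variable {R}

theorem inner_eq_zero_of_mem_cascade {β β' : V} (h : β ∈ R.cascade) (h' : β' ∈ R.cascade)
    (hne : β ≠ β') : ⟪β, β'⟫_ℝ = 0 := by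
  rw [mem_cascade_iff] at h h'
  rcases h.relation h' with h1 | h1 | h1 | h1
  · exact absurd (h.isHighest.unique (h1 ▸ h'.isHighest)) hne
  · rw [real_inner_comm]; exact (h1 h'.isHighest.1).2
  · exact (h1 h.isHighest.1).2
  · exact h1 _ h.isHighest.1 _ h'.isHighest.1

theorem mem_sub_or_inner_eq_zero {β β' : V} (h : β ∈ R.cascade) (h' : β' ∈ R.cascade) :
    β' ∈ R.sub β ∨ ∀ φ ∈ R.sub β, ⟪φ, β'⟫_ℝ = 0 := by
  rw [mem_cascade_iff] at h h'
  rcases h.relation h' with h1 | h1 | h1 | h1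
  · exact Or.inl (h1 ▸ h'.isHighest.1)
  · exact Or.inl (h1 h'.isHighest.1).1
  · exact Or.inr fun φ hφ => (h1 hφ).2
  · exact Or.inr fun φ hφ => h1 φ hφ _ h'.isHighest.1

theorem ne_zero_of_mem_cascade {β : V} (h : β ∈ R.cascade) : β ≠ 0 :=
  R.pos_ne_zero ((R.mem_cascade_iff).1 h).isHighest.2.1

theorem reflectRoot_mem_sub {β γ φ : V} (hγ : γ ∈ R.sub β) (hφ : φ ∈ R.sub β) :
    reflectRoot γ φ ∈ R.sub β :=
  ⟨R.reflectRoot_mem hφ.1 hγ.1, Submodule.sub_mem _ hφ.2 (Submodule.smul_mem _ _ hγ.2)⟩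

end RootSystemData

section ReflectProd

variable {V : Type*} [NormedAddCommGroup V] [InnerProductSpace ℝ V]

/-- The composition of the reflections in the members of a list. -/
noncomputable def reflectProd (l : List V) : V → V :=
  l.foldr (fun β f => reflectRoot β ∘ f) id

theorem reflectProd_cons (β : V) (l : List V) (v : V) :
    reflectProd (β :: l) v = reflectRoot β (reflectProd l v) := rfl

theorem reflectProd_injective {l : List V} (h : ∀ β ∈ l, β ≠ 0) :
    Function.Injective (reflectProd l) := by
  induction l with
  | nil => exact Function.injective_id
  | cons β l ih =>
    exact (reflectRoot_injective (h β (by simp))).comp (ih fun γ hγ => h γ (by simp [hγ]))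

theorem mapsTo_reflectProd {l : List V} {S : Set V}
    (h : ∀ β ∈ l, Set.MapsTo (reflectRoot β) S S) : Set.MapsTo (reflectProd l) S S := by
  induction l with
  | nil => exact Set.mapsTo_id S
  | cons β l ih => exact (h β (by simp)).comp (ih fun γ hγ => h γ (by simp [hγ]))

theorem inner_reflectProd_of_orthogonal {l : List V} {β : V} (h : ∀ γ ∈ l, ⟪γ, β⟫_ℝ = 0) (v : V) :
    ⟪reflectProd l v, β⟫_ℝ = ⟪v, β⟫_ℝ := by
  induction l with
  | nil => rfl
  | cons γ l ih =>
    rw [reflectProd_cons, inner_reflectRoot, h γ (by simp), mul_zero, sub_zero,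
      ih fun δ hδ => h δ (by simp [hδ])]

theorem inner_reflectProd_of_mem {l : List V} (hnd : l.Nodup) {β : V} (hβ : β ∈ l) (hβ0 : β ≠ 0)
    (h : ∀ γ ∈ l, γ ≠ β → ⟪γ, β⟫_ℝ = 0) (v : V) :
    ⟪reflectProd l v, β⟫_ℝ = -⟪v, β⟫_ℝ := by
  induction l with
  | nil => simp at hβ
  | cons γ l ih =>
    rw [List.nodup_cons] at hnd
    rw [reflectProd_cons]
    by_cases hγ : γ = β
    · subst hγ
      rw [inner_reflectRoot_self hβ0, inner_reflectProd_of_orthogonal]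
      intro δ hδ
      exact h δ (by simp [hδ]) fun h' => hnd.1 (h' ▸ hδ)
    · rw [inner_reflectRoot, h γ (by simp) hγ, mul_zero, sub_zero]
      exact ih hnd.2 ((List.mem_cons.1 hβ).resolve_left fun h' => hγ h'.symm)
        fun δ hδ => h δ (by simp [hδ])

theorem reflectProd_filter {l : List V} {W : Submodule ℝ V} (p : V → Prop) [DecidablePred p]
    (hp : ∀ γ ∈ l, p γ → γ ∈ W) (hn : ∀ γ ∈ l, ¬ p γ → ∀ w ∈ W, ⟪w, γ⟫_ℝ = 0) {v : V} (hv : v ∈ W) :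
    reflectProd l v = reflectProd (l.filter fun γ => p γ) v ∧ reflectProd l v ∈ W := by
  induction l with
  | nil => exact ⟨rfl, hv⟩
  | cons γ l ih =>
    obtain ⟨h1, h2⟩ := ih (fun δ hδ => hp δ (by simp [hδ])) fun δ hδ => hn δ (by simp [hδ])
    by_cases hγ : p γ
    · rw [List.filter_cons_of_pos (by simpa using hγ), reflectProd_cons, reflectProd_cons, ← h1]
      exact ⟨rfl, W.sub_mem h2 (W.smul_mem _ (hp γ (by simp) hγ))⟩
    · rw [List.filter_cons_of_neg (by simpa using hγ), reflectProd_cons,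
        reflectRoot_of_inner_eq_zero (hn γ (by simp) hγ _ h2)]
      exact ⟨h1, h2⟩

theorem image_eq_image_of_mapsTo {α : Type*} {f g : α → α} {S : Set α} (hS : S.Finite)
    (hf : Function.Injective f) (hg : Function.Injective g) (h : ∀ x ∈ S, f x ∈ g '' S) :
    f '' S = g '' S := by
  refine Set.eq_of_subset_of_ncard_le (Set.image_subset_iff.2 h) ?_ (hS.image g)
  rw [Set.ncard_image_of_injective _ hf, Set.ncard_image_of_injective _ hg]

end ReflectProd

namespace RootSystemData

variable {V : Type*} [NormedAddCommGroup V] [InnerProductSpace ℝ V] {R : RootSystemData V}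

theorem mapsTo_reflectRoot_sub {β γ : V} (hβ : β ∈ R.cascade) (hγ : γ ∈ R.cascade) :
    Set.MapsTo (reflectRoot γ) (R.sub β) (R.sub β) := by
  intro φ hφ
  rcases mem_sub_or_inner_eq_zero hβ hγ with h | h
  · exact reflectRoot_mem_sub h hφ
  · rwa [reflectRoot_of_inner_eq_zero (h φ hφ)]

theorem mapsTo_reflectProd_sub {l : List V} (hl : ∀ β ∈ l, β ∈ R.cascade) {β : V}
    (hβ : β ∈ R.cascade) : Set.MapsTo (reflectProd l) (R.sub β) (R.sub β) :=
  mapsTo_reflectProd fun _ hγ => mapsTo_reflectRoot_sub hβ (hl _ hγ)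

theorem neg_reflectProd_mem_pos {l : List V} (hnd : l.Nodup) (hl : ∀ β, β ∈ l ↔ β ∈ R.cascade)
    {φ : V} (hφ : φ ∈ R.Pos) : -reflectProd l φ ∈ R.Pos := by
  obtain ⟨C, β, h, hφC, hpos⟩ := R.exists_isNode_inner_pos hφ
  obtain rfl := h.sub_eq
  have hβ : β ∈ R.cascade := R.mem_cascade_iff.2 h
  have hmem := mapsTo_reflectProd_sub (fun γ => (hl γ).1) hβ hφC
  refine (R.mem_or_neg _ hmem.1).resolve_left fun hp => ?_
  have h1 := h.inner_nonneg hmem hp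
  rw [inner_reflectProd_of_mem hnd ((hl β).2 hβ) (ne_zero_of_mem_cascade hβ)
    (fun γ hγ hne => inner_eq_zero_of_mem_cascade ((hl γ).1 hγ) hβ hne)] at h1
  linarith

end RootSystemData

/-- The reflections `s_β`, `β ∈ ℬ`, pairwise commute and their product, in
any order, equals the longest element `w₀` of the Weyl group (characterized by
`w₀(Δ₊) = −Δ₊`).  Moreover `w₀` maps each `Δ(β)` onto itself and its restriction to the
span of `Δ(β)` coincides with that of the longest element of the Weyl group of `Δ(β)`
(an element of the Weyl group of `Δ(β)` sending `Δ(β)₊` to `−Δ(β)₊`). -/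
theorem statement8 {V : Type*} [NormedAddCommGroup V] [InnerProductSpace ℝ V]
    (R : RootSystemData V) :
    (∀ β ∈ R.cascade, ∀ β' ∈ R.cascade,
      reflectRoot β ∘ reflectRoot β' = reflectRoot β' ∘ reflectRoot β) ∧
    ∀ l : List V, l.Nodup → (∀ β, β ∈ l ↔ β ∈ R.cascade) →
      (l.foldr (fun β f => reflectRoot β ∘ f) id) '' R.Pos = Neg.neg '' R.Pos ∧
      ∀ β ∈ R.cascade,
        (l.foldr (fun β f => reflectRoot β ∘ f) id) '' R.sub β = R.sub β ∧
        ∃ m : List V, (∀ γ ∈ m, γ ∈ R.sub β) ∧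
          (m.foldr (fun γ f => reflectRoot γ ∘ f) id) '' R.posSub β
            = Neg.neg '' R.posSub β ∧
          ∀ v ∈ Submodule.span ℝ (R.sub β),
            (l.foldr (fun β f => reflectRoot β ∘ f) id) v
              = (m.foldr (fun γ f => reflectRoot γ ∘ f) id) v := by
  classical
  refine ⟨fun β hβ β' hβ' => ?_, fun l hnd hl => ?_⟩
  · by_cases hne : β = β'
    · rw [hne]
    · exact reflectRoot_comm_of_inner_eq_zero
        (RootSystemData.inner_eq_zero_of_mem_cascade hβ hβ' hne)
  have hinj : Function.Injective (reflectProd l) :=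
    reflectProd_injective fun β hβ => RootSystemData.ne_zero_of_mem_cascade ((hl β).1 hβ)
  have hneg : ∀ φ ∈ R.Pos, -reflectProd l φ ∈ R.Pos := fun φ hφ =>
    RootSystemData.neg_reflectProd_mem_pos hnd hl hφ
  refine ⟨image_eq_image_of_mapsTo R.finite_pos hinj neg_injective
    fun φ hφ => ⟨_, hneg φ hφ, neg_neg _⟩, fun β hβ => ?_⟩
  have hmaps := RootSystemData.mapsTo_reflectProd_sub (fun γ => (hl γ).1) hβ
  have hfin : (R.sub β).Finite := R.finite.subset fun _ h => h.1
  have hfilter : ∀ v ∈ Submodule.span ℝ (R.sub β),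
      reflectProd l v = reflectProd (l.filter fun γ => γ ∈ R.sub β) v := by
    intro v hv
    refine (reflectProd_filter (fun γ => γ ∈ R.sub β) (fun γ _ h => Submodule.subset_span h)
      (fun γ hγ hn w hw => ?_) hv).1
    have horth := (RootSystemData.mem_sub_or_inner_eq_zero hβ ((hl γ).1 hγ)).resolve_left hn
    exact inner_eq_zero_of_mem_span (B := {γ}) (by simpa using horth) hw
      (Submodule.mem_span_singleton_self γ)
  refine ⟨?_, l.filter fun γ => γ ∈ R.sub β, by simp, ?_, hfilter⟩
  · have := image_eq_image_of_mapsTo hfin hinj Function.injective_id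
      (by simpa using fun φ hφ => hmaps hφ)
    rwa [Set.image_id] at this
  · refine image_eq_image_of_mapsTo (f := reflectProd (l.filter fun γ => γ ∈ R.sub β))
      (hfin.subset Set.inter_subset_left) (reflectProd_injective fun γ hγ => ?_) neg_injective
      fun φ hφ => ⟨-reflectProd l φ, ⟨?_, hneg φ hφ.2⟩, ?_⟩
    · exact RootSystemData.ne_zero_of_mem_cascade ((hl γ).1 (List.mem_of_mem_filter hγ))
    · exact ⟨R.neg_mem _ (hmaps hφ.1).1, Submodule.neg_mem _ (hmaps hφ.1).2⟩
    · rw [neg_neg, hfilter φ (Submodule.subset_span hφ.1)]
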